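/- Each of the three Laplace–Runge–Lenz components L₁ = −J₀₂J₁₂ − J₀₃J₁₃ + kκ₂Cκ₂(θ), L₂ = J₀₁J₁₂ − J₀₃J₂₃ + kκ₂Sκ₂(θ)cos φ, and L₃ = J₀₁J₁₃ + J₀₂J₂₃ + kκ₂Sκ₂(θ)sin φ Poisson commutes with the Kepler–Coulomb Hamiltonian H^KC = T − k/Tκ₁(r) at every point of D. -/

import Mathlib

namespace Paper
noncomputable section

/-- The κ-dependent cosine Cκ(x) = ∑ (−κ)^l x^{2l}/(2l)!. -/
def Ck (κ x : ℝ) : ℝ := ∑' l : ℕ, (-κ) ^ l * x ^ (2 * l) / (Nat.factorial (2 * l) : ℝ)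

/-- The κ-dependent sine Sκ(x) = ∑ (−κ)^l x^{2l+1}/(2l+1)!. -/
def Sk (κ x : ℝ) : ℝ := ∑' l : ℕ, (-κ) ^ l * x ^ (2 * l + 1) / (Nat.factorial (2 * l + 1) : ℝ)

/-- The κ-dependent tangent Tκ(x) = Sκ(x)/Cκ(x). -/
def Tk (κ x : ℝ) : ℝ := Sk κ x / Ck κ x

/-- Phase space ℝ³ × ℝ³ ≃ ℝ⁶ with canonical coordinates
`(r, θ, φ, p_r, p_θ, p_φ) = (x 0, x 1, x 2, x 3, x 4, x 5)`. -/
abbrev Pt := Fin 6 → ℝ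

/-- Partial derivative in the i-th coordinate direction. -/
def pd (f : Pt → ℝ) (i : Fin 6) (x : Pt) : ℝ := fderiv ℝ f x (Pi.single i 1)

/-- Canonical Poisson bracket {f,g} = ∑_{q} (∂f/∂q ∂g/∂p_q − ∂g/∂q ∂f/∂p_q). -/
def pb (f g : Pt → ℝ) (x : Pt) : ℝ :=
  ∑ i : Fin 3,
    (pd f ⟨i.1, by omega⟩ x * pd g ⟨i.1 + 3, by omega⟩ x
      - pd g ⟨i.1, by omega⟩ x * pd f ⟨i.1 + 3, by omega⟩ x)

/-- Gradient of a function on phase space, as a vector in ℝ⁶. -/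
def grad (f : Pt → ℝ) (x : Pt) : Fin 6 → ℝ := fun i => pd f i x

/-- The open domain D where Sκ₁(r), Cκ₁(r), Sκ₂(θ), Cκ₂(θ), cos φ, sin φ are nonzero. -/
def D (κ₁ κ₂ : ℝ) : Set Pt :=
  {x | Sk κ₁ (x 0) ≠ 0 ∧ Ck κ₁ (x 0) ≠ 0 ∧ Sk κ₂ (x 1) ≠ 0 ∧ Ck κ₂ (x 1) ≠ 0 ∧
       Real.cos (x 2) ≠ 0 ∧ Real.sin (x 2) ≠ 0}

/-- J₀₁ = Cκ₂(θ)p_r − (Sκ₂(θ)/Tκ₁(r))p_θ. -/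
def J01 (κ₁ κ₂ : ℝ) (x : Pt) : ℝ :=
  Ck κ₂ (x 1) * x 3 - (Sk κ₂ (x 1) / Tk κ₁ (x 0)) * x 4

/-- J₀₂. -/
def J02 (κ₁ κ₂ : ℝ) (x : Pt) : ℝ :=
  κ₂ * Sk κ₂ (x 1) * Real.cos (x 2) * x 3
    + (Ck κ₂ (x 1) * Real.cos (x 2) / Tk κ₁ (x 0)) * x 4
    - (Real.sin (x 2) / (Tk κ₁ (x 0) * Sk κ₂ (x 1))) * x 5

/-- J₀₃. -/
def J03 (κ₁ κ₂ : ℝ) (x : Pt) : ℝ :=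
  κ₂ * Sk κ₂ (x 1) * Real.sin (x 2) * x 3
    + (Ck κ₂ (x 1) * Real.sin (x 2) / Tk κ₁ (x 0)) * x 4
    + (Real.cos (x 2) / (Tk κ₁ (x 0) * Sk κ₂ (x 1))) * x 5

/-- J₁₂ = cos φ·p_θ − (sin φ/Tκ₂(θ))p_φ. -/
def J12 (κ₂ : ℝ) (x : Pt) : ℝ :=
  Real.cos (x 2) * x 4 - (Real.sin (x 2) / Tk κ₂ (x 1)) * x 5

/-- J₁₃ = sin φ·p_θ + (cos φ/Tκ₂(θ))p_φ. -/
def J13 (κ₂ : ℝ) (x : Pt) : ℝ :=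
  Real.sin (x 2) * x 4 + (Real.cos (x 2) / Tk κ₂ (x 1)) * x 5

/-- J₂₃ = p_φ. -/
def J23 (x : Pt) : ℝ := x 5

/-- Kinetic energy T. -/
def Tkin (κ₁ κ₂ : ℝ) (x : Pt) : ℝ :=
  (1 / 2) * ((x 3) ^ 2 + (x 4) ^ 2 / (κ₂ * Sk κ₁ (x 0) ^ 2)
    + (x 5) ^ 2 / (κ₂ * Sk κ₁ (x 0) ^ 2 * Sk κ₂ (x 1) ^ 2))

/-- The superintegrable potential U with arbitrary radial function F. -/
def U (κ₁ κ₂ : ℝ) (F : ℝ → ℝ) (β₁ β₂ β₃ : ℝ) (x : Pt) : ℝ :=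
  F (x 0) + (1 / Sk κ₁ (x 0) ^ 2) *
    (β₁ / Ck κ₂ (x 1) ^ 2 + β₂ / (Sk κ₂ (x 1) ^ 2 * Real.cos (x 2) ^ 2)
      + β₃ / (Sk κ₂ (x 1) ^ 2 * Real.sin (x 2) ^ 2))

/-- Integral I₁₂. -/
def I12 (κ₂ β₁ β₂ : ℝ) (x : Pt) : ℝ :=
  (Real.cos (x 2) * x 4 - (Real.sin (x 2) / Tk κ₂ (x 1)) * x 5) ^ 2
    + 2 * β₁ * κ₂ ^ 2 * Tk κ₂ (x 1) ^ 2 * Real.cos (x 2) ^ 2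
    + 2 * β₂ * κ₂ / (Tk κ₂ (x 1) ^ 2 * Real.cos (x 2) ^ 2)

/-- Integral I₁₃. -/
def I13 (κ₂ β₁ β₃ : ℝ) (x : Pt) : ℝ :=
  (Real.sin (x 2) * x 4 + (Real.cos (x 2) / Tk κ₂ (x 1)) * x 5) ^ 2
    + 2 * β₁ * κ₂ ^ 2 * Tk κ₂ (x 1) ^ 2 * Real.sin (x 2) ^ 2
    + 2 * β₃ * κ₂ / (Tk κ₂ (x 1) ^ 2 * Real.sin (x 2) ^ 2)

/-- Integral I₂₃. -/
def I23 (κ₂ β₂ β₃ : ℝ) (x : Pt) : ℝ :=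
  (x 5) ^ 2 + 2 * β₂ * κ₂ * Real.tan (x 2) ^ 2 + 2 * β₃ * κ₂ / Real.tan (x 2) ^ 2

/-- Integral I₁₂₃. -/
def I123 (κ₂ β₁ β₂ β₃ : ℝ) (x : Pt) : ℝ :=
  (x 4) ^ 2 + (x 5) ^ 2 / Sk κ₂ (x 1) ^ 2 + 2 * β₁ * κ₂ / Ck κ₂ (x 1) ^ 2
    + 2 * β₂ * κ₂ / (Sk κ₂ (x 1) ^ 2 * Real.cos (x 2) ^ 2)
    + 2 * β₃ * κ₂ / (Sk κ₂ (x 1) ^ 2 * Real.sin (x 2) ^ 2)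

/-- The Smorodinsky–Winternitz Hamiltonian H^SW. -/
def HSW (κ₁ κ₂ β₀ β₁ β₂ β₃ : ℝ) (x : Pt) : ℝ :=
  Tkin κ₁ κ₂ x + β₀ * Tk κ₁ (x 0) ^ 2 + (1 / Sk κ₁ (x 0) ^ 2) *
    (β₁ / Ck κ₂ (x 1) ^ 2 + β₂ / (Sk κ₂ (x 1) ^ 2 * Real.cos (x 2) ^ 2)
      + β₃ / (Sk κ₂ (x 1) ^ 2 * Real.sin (x 2) ^ 2))

/-- Integral I₀₁ of H^SW. -/
def I01 (κ₁ κ₂ β₀ β₁ : ℝ) (x : Pt) : ℝ :=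
  J01 κ₁ κ₂ x ^ 2 + 2 * β₀ * Tk κ₁ (x 0) ^ 2 * Ck κ₂ (x 1) ^ 2
    + 2 * β₁ / (Tk κ₁ (x 0) ^ 2 * Ck κ₂ (x 1) ^ 2)

/-- Integral I₀₂ of H^SW. -/
def I02 (κ₁ κ₂ β₀ β₂ : ℝ) (x : Pt) : ℝ :=
  J02 κ₁ κ₂ x ^ 2 + 2 * β₀ * κ₂ ^ 2 * Tk κ₁ (x 0) ^ 2 * Sk κ₂ (x 1) ^ 2 * Real.cos (x 2) ^ 2
    + 2 * β₂ * κ₂ / (Tk κ₁ (x 0) ^ 2 * Sk κ₂ (x 1) ^ 2 * Real.cos (x 2) ^ 2)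

/-- Integral I₀₃ of H^SW. -/
def I03 (κ₁ κ₂ β₀ β₃ : ℝ) (x : Pt) : ℝ :=
  J03 κ₁ κ₂ x ^ 2 + 2 * β₀ * κ₂ ^ 2 * Tk κ₁ (x 0) ^ 2 * Sk κ₂ (x 1) ^ 2 * Real.sin (x 2) ^ 2
    + 2 * β₃ * κ₂ / (Tk κ₁ (x 0) ^ 2 * Sk κ₂ (x 1) ^ 2 * Real.sin (x 2) ^ 2)

/-- Generalized Kepler–Coulomb Hamiltonian H^GKC₁ = T + U^GKC₁. -/
def HGKC1 (κ₁ κ₂ k β₂ β₃ : ℝ) (x : Pt) : ℝ :=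
  Tkin κ₁ κ₂ x - k / Tk κ₁ (x 0)
    + (1 / (Sk κ₁ (x 0) ^ 2 * Sk κ₂ (x 1) ^ 2)) *
        (β₂ / Real.cos (x 2) ^ 2 + β₃ / Real.sin (x 2) ^ 2)

/-- Generalized Kepler–Coulomb Hamiltonian H^GKC₂ = T + U^GKC₂. -/
def HGKC2 (κ₁ κ₂ k β₁ β₃ : ℝ) (x : Pt) : ℝ :=
  Tkin κ₁ κ₂ x - k / Tk κ₁ (x 0)
    + (1 / Sk κ₁ (x 0) ^ 2) *
        (β₁ / Ck κ₂ (x 1) ^ 2 + β₃ / (Sk κ₂ (x 1) ^ 2 * Real.sin (x 2) ^ 2))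

/-- Generalized Kepler–Coulomb Hamiltonian H^GKC₃ = T + U^GKC₃. -/
def HGKC3 (κ₁ κ₂ k β₁ β₂ : ℝ) (x : Pt) : ℝ :=
  Tkin κ₁ κ₂ x - k / Tk κ₁ (x 0)
    + (1 / Sk κ₁ (x 0) ^ 2) *
        (β₁ / Ck κ₂ (x 1) ^ 2 + β₂ / (Sk κ₂ (x 1) ^ 2 * Real.cos (x 2) ^ 2))

/-- The function L₁. -/
def L1 (κ₁ κ₂ k β₂ β₃ : ℝ) (x : Pt) : ℝ :=
  -(J02 κ₁ κ₂ x * J12 κ₂ x) - J03 κ₁ κ₂ x * J13 κ₂ x + k * κ₂ * Ck κ₂ (x 1)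
    - (2 * κ₂ * Ck κ₂ (x 1) / (Tk κ₁ (x 0) * Sk κ₂ (x 1) ^ 2)) *
        (β₂ / Real.cos (x 2) ^ 2 + β₃ / Real.sin (x 2) ^ 2)

/-- The function L₂. -/
def L2 (κ₁ κ₂ k β₁ β₃ : ℝ) (x : Pt) : ℝ :=
  J01 κ₁ κ₂ x * J12 κ₂ x - J03 κ₁ κ₂ x * J23 x + k * κ₂ * Sk κ₂ (x 1) * Real.cos (x 2)
    - (2 * κ₂ * Real.cos (x 2) / Tk κ₁ (x 0)) *
        (β₁ * Sk κ₂ (x 1) / Ck κ₂ (x 1) ^ 2 + β₃ / (Sk κ₂ (x 1) * Real.sin (x 2) ^ 2))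

/-- The function L₃. -/
def L3 (κ₁ κ₂ k β₁ β₂ : ℝ) (x : Pt) : ℝ :=
  J01 κ₁ κ₂ x * J13 κ₂ x + J02 κ₁ κ₂ x * J23 x + k * κ₂ * Sk κ₂ (x 1) * Real.sin (x 2)
    - (2 * κ₂ * Real.sin (x 2) / Tk κ₁ (x 0)) *
        (β₁ * Sk κ₂ (x 1) / Ck κ₂ (x 1) ^ 2 + β₂ / (Sk κ₂ (x 1) * Real.cos (x 2) ^ 2))

theorem Ck_sq {a : ℝ} (x : ℝ) : Ck (a ^ 2) x = Real.cos (a * x) := by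
  rw [Real.cos_eq_tsum, Ck]
  congr 1 with l
  rw [neg_pow, mul_pow a, pow_mul a]
  ring

theorem Ck_neg_sq {a : ℝ} (x : ℝ) : Ck (-a ^ 2) x = Real.cosh (a * x) := by
  rw [Real.cosh_eq_tsum, Ck]
  congr 1 with l
  rw [neg_neg, mul_pow a, pow_mul a]

theorem Sk_sq {a : ℝ} (ha : a ≠ 0) (x : ℝ) : Sk (a ^ 2) x = Real.sin (a * x) / a := by
  rw [Real.sin_eq_tsum, Sk, ← tsum_div_const]
  congr 1 with l
  rw [neg_pow, mul_pow a, pow_succ a (2 * l), pow_mul a]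
  field_simp

theorem Sk_neg_sq {a : ℝ} (ha : a ≠ 0) (x : ℝ) : Sk (-a ^ 2) x = Real.sinh (a * x) / a := by
  rw [Real.sinh_eq_tsum, Sk, ← tsum_div_const]
  congr 1 with l
  rw [neg_neg, mul_pow a, pow_succ a (2 * l), pow_mul a]
  field_simp

theorem Ck_zero (x : ℝ) : Ck 0 x = 1 := by
  rw [Ck, tsum_eq_single 0 fun l hl => by simp [hl]]
  simp

theorem Sk_zero (x : ℝ) : Sk 0 x = x := by
  rw [Sk, tsum_eq_single 0 fun l hl => by simp [hl]]
  simp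

theorem eq_sq_or_zero_or_neg_sq (κ : ℝ) :
    (∃ a : ℝ, a ≠ 0 ∧ κ = a ^ 2) ∨ κ = 0 ∨ ∃ a : ℝ, a ≠ 0 ∧ κ = -a ^ 2 := by
  rcases lt_trichotomy κ 0 with h | h | h
  · exact .inr (.inr ⟨√(-κ), by positivity [neg_pos.2 h], by rw [Real.sq_sqrt (by linarith)]; ring⟩)
  · exact .inr (.inl h)
  · exact .inl ⟨√κ, by positivity, (Real.sq_sqrt h.le).symm⟩

theorem Ck_sq_add_mul_Sk_sq (κ x : ℝ) : Ck κ x ^ 2 + κ * Sk κ x ^ 2 = 1 := by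
  rcases eq_sq_or_zero_or_neg_sq κ with ⟨a, ha, rfl⟩ | rfl | ⟨a, ha, rfl⟩
  · rw [Ck_sq, Sk_sq ha]
    field_simp
    exact Real.cos_sq_add_sin_sq _
  · simp [Ck_zero]
  · rw [Ck_neg_sq, Sk_neg_sq ha]
    field_simp
    linarith [Real.cosh_sq_sub_sinh_sq (a * x)]

theorem hasDerivAt_Ck (κ x : ℝ) : HasDerivAt (Ck κ) (-κ * Sk κ x) x := by
  rcases eq_sq_or_zero_or_neg_sq κ with ⟨a, ha, rfl⟩ | rfl | ⟨a, ha, rfl⟩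
  · rw [funext (Ck_sq (a := a)), Sk_sq ha]
    have h : HasDerivAt (fun t => a * t) a x := by simpa using (hasDerivAt_id x).const_mul a
    exact h.cos.congr_deriv (by field_simp)
  · rw [funext Ck_zero]
    simpa using hasDerivAt_const x (1 : ℝ)
  · rw [funext (Ck_neg_sq (a := a)), Sk_neg_sq ha]
    have h : HasDerivAt (fun t => a * t) a x := by simpa using (hasDerivAt_id x).const_mul a
    exact h.cosh.congr_deriv (by field_simp)

theorem hasDerivAt_Sk (κ x : ℝ) : HasDerivAt (Sk κ) (Ck κ x) x := by
  rcases eq_sq_or_zero_or_neg_sq κ with ⟨a, ha, rfl⟩ | rfl | ⟨a, ha, rfl⟩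
  · rw [funext (Sk_sq ha), Ck_sq]
    have h : HasDerivAt (fun t => a * t) a x := by simpa using (hasDerivAt_id x).const_mul a
    exact (h.sin.div_const a).congr_deriv (by field_simp)
  · rw [funext Sk_zero, Ck_zero]
    exact hasDerivAt_id x
  · rw [funext (Sk_neg_sq ha), Ck_neg_sq]
    have h : HasDerivAt (fun t => a * t) a x := by simpa using (hasDerivAt_id x).const_mul a
    exact (h.sinh.div_const a).congr_deriv (by field_simp)

theorem hasDerivAt_inv_Sk {κ x : ℝ} (h : Sk κ x ≠ 0) :
    HasDerivAt (fun t => (Sk κ t)⁻¹) (-Ck κ x / Sk κ x ^ 2) x :=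
  (hasDerivAt_Sk κ x).inv h

theorem hasDerivAt_inv_Tk {κ x : ℝ} (h : Sk κ x ≠ 0) :
    HasDerivAt (fun t => (Tk κ t)⁻¹) (-1 / Sk κ x ^ 2) x := by
  simp only [Tk, inv_div]
  refine ((hasDerivAt_Ck κ x).fun_div (hasDerivAt_Sk κ x) h).congr_deriv ?_
  congr 1
  linarith [Ck_sq_add_mul_Sk_sq κ x]

theorem hasFDerivAt_comp_apply {u : ℝ → ℝ} {u' : ℝ} {x : Pt} (i : Fin 6)
    (h : HasDerivAt u u' (x i)) :
    HasFDerivAt (fun y : Pt => u (y i))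
      (u' • (ContinuousLinearMap.proj i : Pt →L[ℝ] ℝ)) x :=
  h.comp_hasFDerivAt x (hasFDerivAt_apply i x)

theorem hasFDerivAt_coord (i : Fin 6) (x : Pt) :
    HasFDerivAt (fun y : Pt => y i) (ContinuousLinearMap.proj i : Pt →L[ℝ] ℝ) x :=
  hasFDerivAt_apply i x

/-- The Hamiltonian vector field of `g`. -/
def hamVec (g : Pt → ℝ) (x : Pt) : Pt :=
  ![pd g 3 x, pd g 4 x, pd g 5 x, -pd g 0 x, -pd g 1 x, -pd g 2 x]

theorem pb_eq_hamVec {f g : Pt → ℝ} {f' : Pt →L[ℝ] ℝ} {x : Pt} (hf : HasFDerivAt f f' x) :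
    pb f g x = f' (hamVec g x) := by
  have hv : hamVec g x = ∑ i, hamVec g x i • (Pi.single i 1 : Pt) := by
    simp [← Pi.single_smul, Finset.univ_sum_single]
  rw [hv, map_sum]
  simp only [map_smul, smul_eq_mul, Fin.sum_univ_six, pb, Fin.sum_univ_three, pd, hf.fderiv]
  simp [hamVec, pd]
  ring

/-- The Kepler–Coulomb Hamiltonian. -/
def HKC (κ₁ κ₂ k : ℝ) (y : Pt) : ℝ := Tkin κ₁ κ₂ y - k / Tk κ₁ (y 0)

theorem hamVec_HKC (κ₁ κ₂ k : ℝ) {x : Pt} (h₁ : Sk κ₁ (x 0) ≠ 0) (h₂ : Sk κ₂ (x 1) ≠ 0) :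
    hamVec (HKC κ₁ κ₂ k) x =
      ![x 3, x 4 / (κ₂ * Sk κ₁ (x 0) ^ 2), x 5 / (κ₂ * Sk κ₁ (x 0) ^ 2 * Sk κ₂ (x 1) ^ 2),
        Ck κ₁ (x 0) / (κ₂ * Sk κ₁ (x 0) ^ 3) * (x 4 ^ 2 + x 5 ^ 2 / Sk κ₂ (x 1) ^ 2)
          - k / Sk κ₁ (x 0) ^ 2,
        x 5 ^ 2 * Ck κ₂ (x 1) / (κ₂ * Sk κ₁ (x 0) ^ 2 * Sk κ₂ (x 1) ^ 3), 0] := by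
  have hS₁ := hasFDerivAt_comp_apply 0 (hasDerivAt_inv_Sk h₁)
  have hS₂ := hasFDerivAt_comp_apply 1 (hasDerivAt_inv_Sk h₂)
  have hT₁ := hasFDerivAt_comp_apply 0 (hasDerivAt_inv_Tk h₁)
  have h := ((((hasFDerivAt_coord 3 x).pow 2).add
    ((((hasFDerivAt_coord 4 x).mul hS₁).pow 2).const_mul κ₂⁻¹)).add
    (((((hasFDerivAt_coord 5 x).mul hS₁).mul hS₂).pow 2).const_mul κ₂⁻¹)).const_mul (1 / 2)
      |>.sub (hT₁.const_mul k)
  have hH : HasFDerivAt (HKC κ₁ κ₂ k) _ x := h.congr_of_eventuallyEq <| .of_forall fun y => by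
    simp [HKC, Tkin]
    ring
  simp only [hamVec, pd, hH.fderiv]
  ext i
  fin_cases i <;> simp <;> field_simp
  ring

/-- `f` is differentiable at `x` and `{f, g} = d` there. -/
def HasBracket (f g : Pt → ℝ) (d : ℝ) (x : Pt) : Prop :=
  DifferentiableAt ℝ f x ∧ pb f g x = d

namespace HasBracket

variable {f₁ f₂ g : Pt → ℝ} {d₁ d₂ : ℝ} {x : Pt}

theorem of_hasFDerivAt {f' : Pt →L[ℝ] ℝ} (h : HasFDerivAt f₁ f' x) :
    HasBracket f₁ g (f' (hamVec g x)) x :=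
  ⟨h.differentiableAt, pb_eq_hamVec h⟩

theorem coord (i : Fin 6) : HasBracket (fun y => y i) g (hamVec g x i) x :=
  of_hasFDerivAt (hasFDerivAt_coord i x)

theorem comp_coord {u : ℝ → ℝ} {u' : ℝ} (i : Fin 6) (h : HasDerivAt u u' (x i)) :
    HasBracket (fun y => u (y i)) g (u' * hamVec g x i) x :=
  of_hasFDerivAt (hasFDerivAt_comp_apply i h)

theorem add (h₁ : HasBracket f₁ g d₁ x) (h₂ : HasBracket f₂ g d₂ x) :
    HasBracket (fun y => f₁ y + f₂ y) g (d₁ + d₂) x := by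
  refine ⟨h₁.1.add h₂.1, ?_⟩
  rw [pb_eq_hamVec (h₁.1.hasFDerivAt.fun_add h₂.1.hasFDerivAt), ← h₁.2, ← h₂.2,
    pb_eq_hamVec h₁.1.hasFDerivAt, pb_eq_hamVec h₂.1.hasFDerivAt]
  simp

theorem mul (h₁ : HasBracket f₁ g d₁ x) (h₂ : HasBracket f₂ g d₂ x) :
    HasBracket (fun y => f₁ y * f₂ y) g (f₁ x * d₂ + f₂ x * d₁) x := by
  refine ⟨h₁.1.mul h₂.1, ?_⟩
  rw [pb_eq_hamVec (h₁.1.hasFDerivAt.fun_mul h₂.1.hasFDerivAt), ← h₁.2, ← h₂.2,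
    pb_eq_hamVec h₁.1.hasFDerivAt, pb_eq_hamVec h₂.1.hasFDerivAt]
  simp

theorem neg (h₁ : HasBracket f₁ g d₁ x) : HasBracket (fun y => -f₁ y) g (-d₁) x := by
  refine ⟨h₁.1.neg, ?_⟩
  rw [pb_eq_hamVec h₁.1.hasFDerivAt.fun_neg, ← h₁.2, pb_eq_hamVec h₁.1.hasFDerivAt]
  simp

theorem sub (h₁ : HasBracket f₁ g d₁ x) (h₂ : HasBracket f₂ g d₂ x) :
    HasBracket (fun y => f₁ y - f₂ y) g (d₁ - d₂) x := by
  simpa only [sub_eq_add_neg] using h₁.add h₂.neg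

theorem const_mul (c : ℝ) (h₁ : HasBracket f₁ g d₁ x) :
    HasBracket (fun y => c * f₁ y) g (c * d₁) x := by
  refine ⟨h₁.1.const_mul c, ?_⟩
  rw [pb_eq_hamVec (h₁.1.hasFDerivAt.const_mul c), ← h₁.2, pb_eq_hamVec h₁.1.hasFDerivAt]
  simp

end HasBracket

open HasBracket

theorem hasBracket_J01 {κ₁ κ₂ : ℝ} (k : ℝ) {x : Pt} (hκ₂ : κ₂ ≠ 0) (h₁ : Sk κ₁ (x 0) ≠ 0)
    (h₂ : Sk κ₂ (x 1) ≠ 0) :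
    HasBracket (J01 κ₁ κ₂) (HKC κ₁ κ₂ k) (-(k * Ck κ₂ (x 1) / Sk κ₁ (x 0) ^ 2)) x := by
  have h := ((comp_coord (g := HKC κ₁ κ₂ k) 1 (hasDerivAt_Ck κ₂ (x 1))).mul (coord 3)).sub
    (((comp_coord 1 (hasDerivAt_Sk κ₂ (x 1))).mul
      (comp_coord 0 (hasDerivAt_inv_Tk h₁))).mul (coord 4))
  unfold J01
  simp only [div_eq_mul_inv (Sk κ₂ _)]
  convert h using 1
  have hC := Ck_sq_add_mul_Sk_sq κ₂ (x 1)
  simp [hamVec_HKC, h₁, h₂, Tk]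
  field_simp
  grind

theorem hasBracket_J02 {κ₁ κ₂ : ℝ} (k : ℝ) {x : Pt} (hκ₂ : κ₂ ≠ 0) (h₁ : Sk κ₁ (x 0) ≠ 0)
    (h₂ : Sk κ₂ (x 1) ≠ 0) :
    HasBracket (J02 κ₁ κ₂) (HKC κ₁ κ₂ k)
      (-(k * κ₂ * Sk κ₂ (x 1) * Real.cos (x 2) / Sk κ₁ (x 0) ^ 2)) x := by
  have hc := comp_coord (g := HKC κ₁ κ₂ k) 2 (Real.hasDerivAt_cos (x 2))
  have hs := comp_coord (g := HKC κ₁ κ₂ k) 2 (Real.hasDerivAt_sin (x 2))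
  have hT := comp_coord (g := HKC κ₁ κ₂ k) 0 (hasDerivAt_inv_Tk h₁)
  have h := (((((comp_coord 1 (hasDerivAt_Sk κ₂ (x 1))).const_mul κ₂).mul hc).mul
    (coord 3)).add ((((comp_coord 1 (hasDerivAt_Ck κ₂ (x 1))).mul hc).mul hT).mul
    (coord 4))).sub ((hs.mul (hT.mul (comp_coord 1 (hasDerivAt_inv_Sk h₂)))).mul (coord 5))
  unfold J02
  simp only [div_eq_mul_inv _ (Tk _ _), div_eq_mul_inv _ (Tk _ _ * _), mul_inv]
  convert h using 1
  have hC := Ck_sq_add_mul_Sk_sq κ₂ (x 1)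
  simp [hamVec_HKC, h₁, h₂, Tk]
  field_simp
  grind

theorem hasBracket_J03 {κ₁ κ₂ : ℝ} (k : ℝ) {x : Pt} (hκ₂ : κ₂ ≠ 0) (h₁ : Sk κ₁ (x 0) ≠ 0)
    (h₂ : Sk κ₂ (x 1) ≠ 0) :
    HasBracket (J03 κ₁ κ₂) (HKC κ₁ κ₂ k)
      (-(k * κ₂ * Sk κ₂ (x 1) * Real.sin (x 2) / Sk κ₁ (x 0) ^ 2)) x := by
  have hc := comp_coord (g := HKC κ₁ κ₂ k) 2 (Real.hasDerivAt_cos (x 2))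
  have hs := comp_coord (g := HKC κ₁ κ₂ k) 2 (Real.hasDerivAt_sin (x 2))
  have hT := comp_coord (g := HKC κ₁ κ₂ k) 0 (hasDerivAt_inv_Tk h₁)
  have h := (((((comp_coord 1 (hasDerivAt_Sk κ₂ (x 1))).const_mul κ₂).mul hs).mul
    (coord 3)).add ((((comp_coord 1 (hasDerivAt_Ck κ₂ (x 1))).mul hs).mul hT).mul
    (coord 4))).add ((hc.mul (hT.mul (comp_coord 1 (hasDerivAt_inv_Sk h₂)))).mul (coord 5))
  unfold J03
  simp only [div_eq_mul_inv _ (Tk _ _), div_eq_mul_inv _ (Tk _ _ * _), mul_inv]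
  convert h using 1
  have hC := Ck_sq_add_mul_Sk_sq κ₂ (x 1)
  simp [hamVec_HKC, h₁, h₂, Tk]
  field_simp
  grind

theorem hasBracket_J12 {κ₁ κ₂ : ℝ} (k : ℝ) {x : Pt} (hκ₂ : κ₂ ≠ 0) (h₁ : Sk κ₁ (x 0) ≠ 0)
    (h₂ : Sk κ₂ (x 1) ≠ 0) : HasBracket (J12 κ₂) (HKC κ₁ κ₂ k) 0 x := by
  have hc := comp_coord (g := HKC κ₁ κ₂ k) 2 (Real.hasDerivAt_cos (x 2))
  have hs := comp_coord (g := HKC κ₁ κ₂ k) 2 (Real.hasDerivAt_sin (x 2))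
  have h := (hc.mul (coord 4)).sub
    ((hs.mul (comp_coord 1 (hasDerivAt_inv_Tk h₂))).mul (coord 5))
  unfold J12
  simp only [div_eq_mul_inv _ (Tk _ _)]
  convert h using 1
  simp [hamVec_HKC, h₁, h₂, Tk]
  field_simp
  ring

theorem hasBracket_J13 {κ₁ κ₂ : ℝ} (k : ℝ) {x : Pt} (hκ₂ : κ₂ ≠ 0) (h₁ : Sk κ₁ (x 0) ≠ 0)
    (h₂ : Sk κ₂ (x 1) ≠ 0) : HasBracket (J13 κ₂) (HKC κ₁ κ₂ k) 0 x := by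
  have hc := comp_coord (g := HKC κ₁ κ₂ k) 2 (Real.hasDerivAt_cos (x 2))
  have hs := comp_coord (g := HKC κ₁ κ₂ k) 2 (Real.hasDerivAt_sin (x 2))
  have h := (hs.mul (coord 4)).add
    ((hc.mul (comp_coord 1 (hasDerivAt_inv_Tk h₂))).mul (coord 5))
  unfold J13
  simp only [div_eq_mul_inv _ (Tk _ _)]
  convert h using 1
  simp [hamVec_HKC, h₁, h₂, Tk]
  field_simp
  ring

theorem hasBracket_J23 {κ₁ κ₂ : ℝ} (k : ℝ) {x : Pt} (h₁ : Sk κ₁ (x 0) ≠ 0)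
    (h₂ : Sk κ₂ (x 1) ≠ 0) : HasBracket J23 (HKC κ₁ κ₂ k) 0 x := by
  have h := coord (g := HKC κ₁ κ₂ k) (x := x) 5
  rw [show hamVec (HKC κ₁ κ₂ k) x 5 = 0 by simp [hamVec_HKC, h₁, h₂]] at h
  exact h

/-- each of the three Laplace–Runge–Lenz components Poisson
commutes with the Kepler–Coulomb Hamiltonian H^KC = T − k/Tκ₁(r) on D. -/
theorem LRL_commutes_with_KC (κ₁ κ₂ k : ℝ) (hκ₂ : κ₂ ≠ 0) :
    ∀ x ∈ D κ₁ κ₂,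
      pb (fun y => -(J02 κ₁ κ₂ y * J12 κ₂ y) - J03 κ₁ κ₂ y * J13 κ₂ y
            + k * κ₂ * Ck κ₂ (y 1))
         (fun y => Tkin κ₁ κ₂ y - k / Tk κ₁ (y 0)) x = 0 ∧
      pb (fun y => J01 κ₁ κ₂ y * J12 κ₂ y - J03 κ₁ κ₂ y * J23 y
            + k * κ₂ * Sk κ₂ (y 1) * Real.cos (y 2))
         (fun y => Tkin κ₁ κ₂ y - k / Tk κ₁ (y 0)) x = 0 ∧
      pb (fun y => J01 κ₁ κ₂ y * J13 κ₂ y + J02 κ₁ κ₂ y * J23 y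
            + k * κ₂ * Sk κ₂ (y 1) * Real.sin (y 2))
         (fun y => Tkin κ₁ κ₂ y - k / Tk κ₁ (y 0)) x = 0 := by
  rintro x ⟨h₁, -, h₂, -, -, -⟩
  have hJ01 := hasBracket_J01 k hκ₂ h₁ h₂
  have hJ02 := hasBracket_J02 k hκ₂ h₁ h₂
  have hJ03 := hasBracket_J03 k hκ₂ h₁ h₂
  have hJ12 := hasBracket_J12 k hκ₂ h₁ h₂
  have hJ13 := hasBracket_J13 k hκ₂ h₁ h₂
  have hJ23 := hasBracket_J23 (κ₂ := κ₂) k h₁ h₂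
  have hC := comp_coord (g := HKC κ₁ κ₂ k) 1 (hasDerivAt_Ck κ₂ (x 1))
  have hS := comp_coord (g := HKC κ₁ κ₂ k) 1 (hasDerivAt_Sk κ₂ (x 1))
  have hc := comp_coord (g := HKC κ₁ κ₂ k) 2 (Real.hasDerivAt_cos (x 2))
  have hs := comp_coord (g := HKC κ₁ κ₂ k) 2 (Real.hasDerivAt_sin (x 2))
  have hcs := Real.cos_sq_add_sin_sq (x 2)
  have hCS := Ck_sq_add_mul_Sk_sq κ₂ (x 1)
  refine ⟨(((hJ02.mul hJ12).neg.sub (hJ03.mul hJ13)).add (hC.const_mul (k * κ₂))).2.trans ?_,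
    (((hJ01.mul hJ12).sub (hJ03.mul hJ23)).add ((hS.const_mul (k * κ₂)).mul hc)).2.trans ?_,
    (((hJ01.mul hJ13).add (hJ02.mul hJ23)).add ((hS.const_mul (k * κ₂)).mul hs)).2.trans ?_⟩
  all_goals
    simp [hamVec_HKC, h₁, h₂, J12, J13, J23, Tk]
    field_simp
    grind

end
end Paper
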